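/- Let d ≥ 1 and let (p_t)_{t≥0} be the marginal laws of a Lévy process on ℝ^d with generating triplet (A, γ, ν). Let Ω, Ω₀ ⊂ ℝ^d be open sets of finite Lebesgue measure with Ω ⊂ Ω₀ and dist(Ω, Ω₀^c) > 0, and set r(x) = |Ω ∩ (Ω₀ + x)| (Lebesgue measure of the intersection), so that r(0) = |Ω|. Then lim_{t→0+} t^{−1} (∫_{ℝ^d} r(x) p_t(dx) − r(0)) = − ∫_Ω ν(y − Ω₀^c) dy, where y − Ω₀^c = {y − z : z ∉ Ω₀}. -/

import Mathlib

open MeasureTheory Filter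
open scoped Topology RealInnerProductSpace ENNReal

section LevyAux

open ProbabilityTheory

section Weight

variable {E : Type*} [NormedAddCommGroup E]

/-- `1 - exp (-‖x‖² / 2) = ∫ (1 - cos ⟨x, ξ⟩) G(dξ)` for the standard Gaussian `G`. -/
noncomputable def gaussWeight (x : E) : ℝ := 1 - Real.exp (-‖x‖ ^ 2 / 2)

lemma gaussWeight_nonneg (x : E) : 0 ≤ gaussWeight x := by
  unfold gaussWeight
  rw [sub_nonneg, Real.exp_le_one_iff]
  have := sq_nonneg ‖x‖
  linarith

lemma continuous_gaussWeight : Continuous (gaussWeight : E → ℝ) := by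
  unfold gaussWeight; fun_prop

lemma gaussWeight_le (x : E) : gaussWeight x ≤ min 1 (‖x‖ ^ 2) := by
  unfold gaussWeight
  refine le_min (by linarith [Real.exp_pos (-‖x‖ ^ 2 / 2)]) ?_
  nlinarith [Real.add_one_le_exp (-‖x‖ ^ 2 / 2), sq_nonneg ‖x‖]

end Weight

variable {E : Type*} [NormedAddCommGroup E] [InnerProductSpace ℝ E]

lemma norm_exp_neg_sub_one_le {z : ℂ} (hz : 0 ≤ z.re) : ‖Complex.exp (-z) - 1‖ ≤ ‖z‖ := by
  have hd : ∀ w : ℂ, HasDerivAt (fun w : ℂ => Complex.exp (-w)) (Complex.exp (-w) * (-1)) w :=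
    fun w => (hasDerivAt_neg w).cexp
  have h := (convex_halfSpace_re_ge 0).norm_image_sub_le_of_norm_hasDerivWithin_le
    (f := fun w : ℂ => Complex.exp (-w)) (C := 1) (x := 0) (y := z)
    (fun w _ => (hd w).hasDerivWithinAt) (fun w hw => by
      have : 0 ≤ w.re := hw
      simpa [Complex.norm_exp] using this) (by simp) hz
  simpa using h

lemma tendsto_inv_mul_exp_neg_mul_sub_one (z : ℂ) {t : ℕ → ℝ} (ht : ∀ n, 0 < t n)
    (ht0 : Tendsto t atTop (𝓝 0)) :
    Tendsto (fun n => ((t n)⁻¹ : ℂ) * (Complex.exp (-(t n : ℂ) * z) - 1)) atTop (𝓝 (-z)) := by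
  have hd : HasDerivAt (fun s : ℝ => Complex.exp (-(s : ℂ) * z)) (-z) 0 := by
    have h1 : HasDerivAt (fun s : ℝ => -(s : ℂ) * z) (-1 * z) 0 :=
      (Complex.ofRealCLM.hasDerivAt (x := (0 : ℝ))).neg.mul_const z
    simpa using h1.cexp
  have h := hd.tendsto_slope_zero
  have htn : Tendsto t atTop (𝓝[≠] 0) :=
    tendsto_nhdsWithin_iff.2 ⟨ht0, Eventually.of_forall fun n => (ht n).ne'⟩
  simpa [Function.comp_def] using h.comp htn

lemma abs_one_sub_cos_inner_le (ξ x : E) :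
    |1 - Real.cos ⟪x, ξ⟫| ≤ (2 + ‖ξ‖ ^ 2) * min 1 (‖x‖ ^ 2) := by
  have h0 : 0 ≤ 1 - Real.cos ⟪x, ξ⟫ := sub_nonneg.2 (Real.cos_le_one _)
  rw [abs_of_nonneg h0]
  have h1 : 1 - Real.cos ⟪x, ξ⟫ ≤ 2 := by linarith [Real.neg_one_le_cos ⟪x, ξ⟫]
  have h2 := Real.one_sub_sq_div_two_le_cos (x := ⟪x, ξ⟫)
  have h3 : ⟪x, ξ⟫ ^ 2 ≤ (‖x‖ * ‖ξ‖) ^ 2 := sq_le_sq.2 (by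
    rw [abs_of_nonneg (by positivity : 0 ≤ ‖x‖ * ‖ξ‖)]; exact abs_real_inner_le_norm x ξ)
  rcases le_total 1 (‖x‖ ^ 2) with h | h
  · rw [min_eq_left h]; nlinarith [sq_nonneg ‖ξ‖]
  · rw [min_eq_right h]; nlinarith [sq_nonneg ‖ξ‖, sq_nonneg ‖x‖, sq_nonneg (‖x‖ * ‖ξ‖)]

lemma norm_exp_I_mul_sub_one_sub_le (a : ℝ) :
    ‖Complex.exp (Complex.I * a) - 1 - Complex.I * a‖ ≤ 2 * a ^ 2 := by
  have hn : ‖Complex.I * (a : ℂ)‖ = |a| := by simp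
  rcases le_total |a| 1 with h | h
  · have := Complex.norm_exp_sub_one_sub_id_le (x := Complex.I * a) (by rwa [hn])
    rw [hn, sq_abs] at this
    nlinarith [sq_nonneg a]
  · have h1 := norm_sub_le (Complex.exp (Complex.I * a) - 1) (Complex.I * a)
    have h2 := Real.norm_exp_I_mul_ofReal_sub_one_le (x := a)
    rw [hn] at h1
    rw [Real.norm_eq_abs] at h2
    nlinarith [sq_abs a]

/-- The integrand in the Lévy–Khintchine formula. -/
noncomputable def levyIntegrand (ξ y : E) : ℂ :=
  Complex.exp (Complex.I * (⟪ξ, y⟫ : ℂ)) - 1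
    - Complex.I * (if ‖y‖ ≤ 1 then (⟪ξ, y⟫ : ℂ) else 0)

lemma norm_levyIntegrand_le (ξ y : E) :
    ‖levyIntegrand ξ y‖ ≤ (2 + 2 * ‖ξ‖ ^ 2) * min 1 (‖y‖ ^ 2) := by
  unfold levyIntegrand
  have h3 : ⟪ξ, y⟫ ^ 2 ≤ (‖ξ‖ * ‖y‖) ^ 2 := sq_le_sq.2 (by
    rw [abs_of_nonneg (by positivity : 0 ≤ ‖ξ‖ * ‖y‖)]; exact abs_real_inner_le_norm ξ y)
  split_ifs with h
  · have := norm_exp_I_mul_sub_one_sub_le ⟪ξ, y⟫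
    rw [min_eq_right (by nlinarith [norm_nonneg y])]
    nlinarith [sq_nonneg ‖y‖]
  · rw [min_eq_left (by nlinarith [norm_nonneg y]), mul_zero, sub_zero]
    have h1 := norm_sub_le (Complex.exp (Complex.I * (⟪ξ, y⟫ : ℂ))) 1
    rw [mul_comm, Complex.norm_exp_ofReal_mul_I, norm_one] at h1
    rw [mul_comm]
    nlinarith [sq_nonneg ‖ξ‖]

/-- Symmetrised second difference of the Lévy–Khintchine integrand: the drift terms cancel. -/
lemma levyIntegrand_second_difference (η ξ y : E) :
    (levyIntegrand (η + ξ) y + levyIntegrand (η - ξ) y) / 2 - levyIntegrand η y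
      = -(((1 - Real.cos ⟪y, ξ⟫ : ℝ) : ℂ) * Complex.exp (⟪y, η⟫ * Complex.I)) := by
  have hc : ((Real.cos ⟪y, ξ⟫ : ℝ) : ℂ) =
      (Complex.exp (⟪y, ξ⟫ * Complex.I) + Complex.exp (-(⟪y, ξ⟫ * Complex.I))) / 2 := by
    rw [Complex.ofReal_cos, Complex.cos, neg_mul]
  have hadd : Complex.exp (Complex.I * (⟪y, η⟫ + ⟪y, ξ⟫ : ℂ)) =
      Complex.exp (⟪y, η⟫ * Complex.I) * Complex.exp (⟪y, ξ⟫ * Complex.I) := by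
    rw [← Complex.exp_add]; ring_nf
  have hsub : Complex.exp (Complex.I * (⟪y, η⟫ - ⟪y, ξ⟫ : ℂ)) =
      Complex.exp (⟪y, η⟫ * Complex.I) * Complex.exp (-(⟪y, ξ⟫ * Complex.I)) := by
    rw [← Complex.exp_add]; ring_nf
  unfold levyIntegrand
  rw [inner_add_left, inner_sub_left, real_inner_comm, real_inner_comm y ξ,
    Complex.ofReal_sub 1, hc, Complex.ofReal_add, Complex.ofReal_sub, hadd, hsub,
    mul_comm Complex.I (⟪y, η⟫ : ℂ)]
  split_ifs <;> push_cast <;> ring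

variable [FiniteDimensional ℝ E] [MeasurableSpace E] [BorelSpace E]

lemma sFinite_of_levy {ν : Measure E} (hν0 : ν {0} = 0)
    (hν : ∫⁻ y, ENNReal.ofReal (min 1 (‖y‖ ^ 2)) ∂ν < ⊤) : SFinite ν := by
  have hm : Measurable fun y : E => ENNReal.ofReal (min 1 (‖y‖ ^ 2)) := by fun_prop
  have hne : ∀ᵐ y ∂ν, ENNReal.ofReal (min 1 (‖y‖ ^ 2)) ≠ 0 := by
    filter_upwards [measure_eq_zero_iff_ae_notMem.1 hν0] with y hy
    have : 0 < ‖y‖ := norm_pos_iff.2 hy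
    simpa using pow_ne_zero 2 this.ne'
  have := isFiniteMeasure_withDensity hν.ne
  rw [← withDensity_inv_same hm hne (by simp)]
  infer_instance

lemma integrable_min_one_norm_sq {ν : Measure E}
    (hν : ∫⁻ y, ENNReal.ofReal (min 1 (‖y‖ ^ 2)) ∂ν < ⊤) :
    Integrable (fun y => min 1 (‖y‖ ^ 2)) ν := by
  refine ⟨by fun_prop, ?_⟩
  rwa [hasFiniteIntegral_iff_ofReal (Eventually.of_forall fun y => by positivity)]

lemma integrable_levyIntegrand {ν : Measure E} (hν : Integrable (fun y => min 1 (‖y‖ ^ 2)) ν)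
    (ξ : E) : Integrable (levyIntegrand ξ) ν := by
  refine (hν.const_mul (2 + 2 * ‖ξ‖ ^ 2)).mono' ?_
    (Eventually.of_forall fun y => norm_levyIntegrand_le ξ y)
  refine Measurable.aestronglyMeasurable ?_
  unfold levyIntegrand
  refine Measurable.sub (by fun_prop) (Measurable.const_mul ?_ _)
  exact Measurable.ite (measurableSet_le measurable_norm measurable_const) (by fun_prop)
    measurable_const

lemma integral_one_sub_cos_stdGaussian (x : E) :
    ∫ ξ, (1 - Real.cos ⟪x, ξ⟫) ∂(stdGaussian E) = gaussWeight x := by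
  have h := congrArg Complex.re (charFun_stdGaussian x)
  rw [charFun_apply] at h
  have hi : Integrable (fun ξ : E => Complex.exp (⟪ξ, x⟫ * Complex.I)) (stdGaussian E) :=
    (integrable_const (1 : ℝ)).mono' (by fun_prop) (by simp [Complex.norm_exp_ofReal_mul_I])
  have hre := integral_re hi
  simp only [RCLike.re_to_complex, Complex.exp_ofReal_mul_I_re] at hre
  rw [← hre] at h
  rw [integral_sub (integrable_const _) ?_]
  · simp_rw [real_inner_comm x] at h ⊢
    rw [h, gaussWeight]
    norm_cast
    simp
  · exact (integrable_const (1 : ℝ)).mono' (by fun_prop)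
      (Eventually.of_forall fun ξ => Real.abs_cos_le_one _)

lemma integrable_norm_sq_stdGaussian : Integrable (fun ξ : E => ‖ξ‖ ^ 2) (stdGaussian E) :=
  (IsGaussian.memLp_id (stdGaussian E) 2 (by simp)).integrable_norm_pow (by simp)

lemma integrable_one_sub_cos_mul_exp {μ : Measure E}
    (hμ : Integrable (fun y => min 1 (‖y‖ ^ 2)) μ) (ξ η : E) :
    Integrable (fun x => ((1 - Real.cos ⟪x, ξ⟫ : ℝ) : ℂ) * Complex.exp (⟪x, η⟫ * Complex.I)) μ := by
  refine (hμ.const_mul (2 + ‖ξ‖ ^ 2)).mono' (by fun_prop) (Eventually.of_forall fun x => ?_)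
  rw [norm_mul, Complex.norm_exp_ofReal_mul_I, mul_one, Complex.norm_real]
  exact abs_one_sub_cos_inner_le ξ x

lemma integrable_prod_one_sub_cos_mul_exp {μ : Measure E} [SFinite μ]
    (hμ : Integrable (fun y => min 1 (‖y‖ ^ 2)) μ) (η : E) :
    Integrable (fun z : E × E =>
      ((1 - Real.cos ⟪z.2, z.1⟫ : ℝ) : ℂ) * Complex.exp (⟪z.2, η⟫ * Complex.I))
      ((stdGaussian E).prod μ) := by
  refine (Integrable.mul_prod (((integrable_const (2 : ℝ)).add
    integrable_norm_sq_stdGaussian)) hμ).mono' (by fun_prop) (Eventually.of_forall fun z => ?_)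
  rw [norm_mul, Complex.norm_exp_ofReal_mul_I, mul_one, Complex.norm_real]
  exact abs_one_sub_cos_inner_le z.1 z.2

lemma integral_gaussWeight_mul_exp {μ : Measure E} [SFinite μ]
    (hμ : Integrable (fun y => min 1 (‖y‖ ^ 2)) μ) (η : E) :
    ∫ x, (gaussWeight x : ℂ) * Complex.exp (⟪x, η⟫ * Complex.I) ∂μ =
      ∫ ξ, ∫ x, ((1 - Real.cos ⟪x, ξ⟫ : ℝ) : ℂ) * Complex.exp (⟪x, η⟫ * Complex.I) ∂μ
        ∂(stdGaussian E) := by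
  rw [integral_integral_swap (integrable_prod_one_sub_cos_mul_exp hμ η)]
  refine integral_congr_ae (Eventually.of_forall fun x => ?_)
  simp only
  rw [integral_mul_const, integral_complex_ofReal, integral_one_sub_cos_stdGaussian]

/-- The finite measure `(1 - exp (-‖x‖² / 2)) μ(dx)`. -/
noncomputable def weighted (μ : Measure E) : Measure E :=
  μ.withDensity fun x => ENNReal.ofReal (gaussWeight x)

lemma isFiniteMeasure_weighted {μ : Measure E} (hμ : Integrable (fun y => min 1 (‖y‖ ^ 2)) μ) :
    IsFiniteMeasure (weighted μ) := by
  refine isFiniteMeasure_withDensity_ofReal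
    (hμ.mono' continuous_gaussWeight.aestronglyMeasurable (Eventually.of_forall fun x => ?_)).2
  rw [Real.norm_eq_abs, abs_of_nonneg (gaussWeight_nonneg x)]
  exact gaussWeight_le x

lemma integral_weighted {F : Type*} [NormedAddCommGroup F] [NormedSpace ℝ F] {μ : Measure E}
    (f : E → F) : ∫ x, f x ∂(weighted μ) = ∫ x, gaussWeight x • f x ∂μ := by
  rw [weighted, integral_withDensity_eq_integral_toReal_smul
    (continuous_gaussWeight.measurable.ennreal_ofReal) (by simp)]
  simp_rw [ENNReal.toReal_ofReal (gaussWeight_nonneg _)]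

lemma charFun_weighted {μ : Measure E} [SFinite μ]
    (hμ : Integrable (fun y => min 1 (‖y‖ ^ 2)) μ) (η : E) :
    charFun (weighted μ) η =
      ∫ ξ, ∫ x, ((1 - Real.cos ⟪x, ξ⟫ : ℝ) : ℂ) * Complex.exp (⟪x, η⟫ * Complex.I) ∂μ
        ∂(stdGaussian E) := by
  rw [charFun_apply, integral_weighted, ← integral_gaussWeight_mul_exp hμ]
  simp_rw [Complex.real_smul]

/-- The normalisation of `μ + δ₀`, a probability measure for every finite measure `μ`. -/
noncomputable def normalizeAddDirac (μ : Measure E) : Measure E :=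
  ENNReal.ofReal (μ.real Set.univ + 1)⁻¹ • (μ + Measure.dirac 0)

lemma isProbabilityMeasure_normalizeAddDirac (μ : Measure E) [IsFiniteMeasure μ] :
    IsProbabilityMeasure (normalizeAddDirac μ) := by
  constructor
  have hpos : 0 < μ.real Set.univ + 1 := by positivity
  rw [normalizeAddDirac, Measure.smul_apply, Measure.add_apply, measure_univ (μ := Measure.dirac _),
    ← ofReal_measureReal, ← ENNReal.ofReal_one, ← ENNReal.ofReal_add measureReal_nonneg zero_le_one,
    smul_eq_mul, ← ENNReal.ofReal_mul (by positivity), inv_mul_cancel₀ hpos.ne']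

lemma integral_normalizeAddDirac {F : Type*} [NormedAddCommGroup F] [NormedSpace ℝ F]
    [CompleteSpace F] {μ : Measure E} {f : E → F} (hf : Integrable f μ) :
    ∫ x, f x ∂(normalizeAddDirac μ) = (μ.real Set.univ + 1)⁻¹ • (∫ x, f x ∂μ + f 0) := by
  rw [normalizeAddDirac, integral_smul_measure, ENNReal.toReal_ofReal (by positivity),
    integral_add_measure hf (integrable_dirac (by simp)), integral_dirac]

lemma charFun_normalizeAddDirac (μ : Measure E) [IsFiniteMeasure μ] (η : E) :
    charFun (normalizeAddDirac μ) η = (μ.real Set.univ + 1 : ℂ)⁻¹ * (charFun μ η + 1) := by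
  rw [charFun_apply, integral_normalizeAddDirac
    ((integrable_const (1 : ℝ)).mono' (by fun_prop) (by simp [Complex.norm_exp_ofReal_mul_I])),
    Complex.real_smul, charFun_apply]
  simp

/-- Lévy's continuity theorem for finite measures. -/
lemma tendsto_integral_of_tendsto_charFun {m : ℕ → Measure E} {m₀ : Measure E}
    [∀ n, IsFiniteMeasure (m n)] [IsFiniteMeasure m₀]
    (h : ∀ η, Tendsto (fun n => charFun (m n) η) atTop (𝓝 (charFun m₀ η)))
    (f : BoundedContinuousFunction E ℝ) :
    Tendsto (fun n => ∫ x, f x ∂(m n)) atTop (𝓝 (∫ x, f x ∂m₀)) := by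
  have hmass : Tendsto (fun n => (m n).real Set.univ) atTop (𝓝 (m₀.real Set.univ)) := by
    have h0 := (Complex.continuous_re.tendsto _).comp (h 0)
    simpa [Function.comp_def, charFun_zero] using h0
  have hpos : 0 < m₀.real Set.univ + 1 := by positivity
  let q : ℕ → ProbabilityMeasure E := fun n =>
    ⟨normalizeAddDirac (m n), isProbabilityMeasure_normalizeAddDirac (m n)⟩
  let q₀ : ProbabilityMeasure E :=
    ⟨normalizeAddDirac m₀, isProbabilityMeasure_normalizeAddDirac m₀⟩
  have hq : Tendsto q atTop (𝓝 q₀) := by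
    refine ProbabilityMeasure.tendsto_of_tendsto_charFun fun η => ?_
    change Tendsto (fun n => charFun (normalizeAddDirac (m n)) η) atTop
      (𝓝 (charFun (normalizeAddDirac m₀) η))
    simp_rw [charFun_normalizeAddDirac]
    refine Tendsto.mul (Tendsto.inv₀ ?_ ?_) ((h η).add_const 1)
    · exact ((Complex.continuous_ofReal.tendsto _).comp hmass).add_const 1
    · exact_mod_cast hpos.ne'
  have hf := ProbabilityMeasure.tendsto_iff_forall_integral_tendsto.1 hq f
  change Tendsto (fun n => ∫ x, f x ∂(normalizeAddDirac (m n))) atTop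
    (𝓝 (∫ x, f x ∂(normalizeAddDirac m₀))) at hf
  simp_rw [integral_normalizeAddDirac (f.integrable _)] at hf
  have key : ∀ μ : Measure E, (μ.real Set.univ + 1) •
      ((μ.real Set.univ + 1)⁻¹ • (∫ x, f x ∂μ + f 0)) - f 0 = ∫ x, f x ∂μ := by
    intro μ
    have : μ.real Set.univ + 1 ≠ 0 := by positivity
    rw [smul_inv_smul₀ this, add_sub_cancel_right]
  simpa only [key] using ((hmass.add_const 1).smul hf).sub_const (f 0)

/-- The Lévy–Khintchine exponent of the triplet `(A, γ, ν)`. -/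
noncomputable def levyExponent (A : E →L[ℝ] E) (γ : E) (ν : Measure E) (ξ : E) : ℂ :=
  (⟪ξ, A ξ⟫ : ℂ) - Complex.I * (⟪ξ, γ⟫ : ℂ) - ∫ y, levyIntegrand ξ y ∂ν

lemma exists_norm_levyExponent_le (A : E →L[ℝ] E) (γ : E) {ν : Measure E}
    (hν : Integrable (fun y => min 1 (‖y‖ ^ 2)) ν) :
    ∃ C, ∀ ξ, ‖levyExponent A γ ν ξ‖ ≤ C * (1 + ‖ξ‖ ^ 2) := by
  refine ⟨‖A‖ + ‖γ‖ + 2 * ∫ y, min 1 (‖y‖ ^ 2) ∂ν, fun ξ => ?_⟩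
  have hA : ‖(⟪ξ, A ξ⟫ : ℂ)‖ ≤ ‖A‖ * ‖ξ‖ ^ 2 := by
    rw [Complex.norm_real]
    calc ‖⟪ξ, A ξ⟫‖ ≤ ‖ξ‖ * ‖A ξ‖ := norm_inner_le_norm _ _
      _ ≤ ‖ξ‖ * (‖A‖ * ‖ξ‖) := by gcongr; exact A.le_opNorm ξ
      _ = ‖A‖ * ‖ξ‖ ^ 2 := by ring
  have hγ : ‖Complex.I * (⟪ξ, γ⟫ : ℂ)‖ ≤ ‖γ‖ * (1 + ‖ξ‖ ^ 2) := by
    rw [norm_mul, Complex.norm_I, one_mul, Complex.norm_real]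
    calc ‖⟪ξ, γ⟫‖ ≤ ‖ξ‖ * ‖γ‖ := norm_inner_le_norm _ _
      _ = ‖γ‖ * ‖ξ‖ := mul_comm _ _
      _ ≤ ‖γ‖ * (1 + ‖ξ‖ ^ 2) := by gcongr; nlinarith [sq_nonneg (‖ξ‖ - 1)]
  have hint : ‖∫ y, levyIntegrand ξ y ∂ν‖ ≤ (2 + 2 * ‖ξ‖ ^ 2) * ∫ y, min 1 (‖y‖ ^ 2) ∂ν := by
    rw [← integral_const_mul]
    exact norm_integral_le_of_norm_le (hν.const_mul _)
      (Eventually.of_forall fun y => norm_levyIntegrand_le ξ y)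
  have h1 := norm_sub_le ((⟪ξ, A ξ⟫ : ℂ) - Complex.I * (⟪ξ, γ⟫ : ℂ)) (∫ y, levyIntegrand ξ y ∂ν)
  have h2 := norm_sub_le (⟪ξ, A ξ⟫ : ℂ) (Complex.I * (⟪ξ, γ⟫ : ℂ))
  unfold levyExponent
  nlinarith [norm_nonneg A]

lemma levyExponent_second_difference (A : E →L[ℝ] E) (γ : E) {ν : Measure E}
    (hν : Integrable (fun y => min 1 (‖y‖ ^ 2)) ν) (η ξ : E) :
    (levyExponent A γ ν (η + ξ) + levyExponent A γ ν (η - ξ)) / 2 - levyExponent A γ ν η =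
      (⟪ξ, A ξ⟫ : ℂ) +
        ∫ y, ((1 - Real.cos ⟪y, ξ⟫ : ℝ) : ℂ) * Complex.exp (⟪y, η⟫ * Complex.I) ∂ν := by
  have hi := integrable_levyIntegrand hν
  have h : ∫ y, ((1 - Real.cos ⟪y, ξ⟫ : ℝ) : ℂ) * Complex.exp (⟪y, η⟫ * Complex.I) ∂ν =
      -((∫ y, levyIntegrand (η + ξ) y ∂ν + ∫ y, levyIntegrand (η - ξ) y ∂ν) / 2
        - ∫ y, levyIntegrand η y ∂ν) := by
    have hi2 : Integrable (fun y => (levyIntegrand (η + ξ) y + levyIntegrand (η - ξ) y) / 2) ν :=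
      ((hi _).add (hi _)).div_const 2
    rw [← integral_add (hi _) (hi _), ← integral_div, ← integral_sub hi2 (hi _), ← integral_neg]
    refine integral_congr_ae (Eventually.of_forall fun y => ?_)
    simp only
    rw [levyIntegrand_second_difference, neg_neg]
  rw [h]
  unfold levyExponent
  simp only [map_add, map_sub, inner_add_left, inner_add_right, inner_sub_left, inner_sub_right]
  push_cast
  ring

lemma integral_one_sub_cos_mul_exp (P : Measure E) [IsProbabilityMeasure P] (ξ η : E) :
    ∫ x, ((1 - Real.cos ⟪x, ξ⟫ : ℝ) : ℂ) * Complex.exp (⟪x, η⟫ * Complex.I) ∂P =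
      charFun P η - (charFun P (η + ξ) + charFun P (η - ξ)) / 2 := by
  have hi : ∀ ζ : E, Integrable (fun x : E => Complex.exp (⟪x, ζ⟫ * Complex.I)) P := fun ζ =>
    (integrable_const (1 : ℝ)).mono' (by fun_prop) (by simp [Complex.norm_exp_ofReal_mul_I])
  have hi2 : Integrable (fun x : E => (Complex.exp (⟪x, η + ξ⟫ * Complex.I) +
      Complex.exp (⟪x, η - ξ⟫ * Complex.I)) / 2) P := ((hi _).add (hi _)).div_const 2
  simp only [charFun_apply]
  rw [← integral_add (hi _) (hi _), ← integral_div, ← integral_sub (hi _) hi2]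
  refine integral_congr_ae (Eventually.of_forall fun x => ?_)
  simp only [inner_add_right, inner_sub_right]
  push_cast
  rw [add_mul, sub_mul, sub_mul, Complex.exp_add, Complex.exp_sub, Complex.cos, neg_mul, Complex.exp_neg]
  ring

lemma integrable_min_one_norm_sq_of_isFiniteMeasure (P : Measure E) [IsFiniteMeasure P] :
    Integrable (fun y => min 1 (‖y‖ ^ 2)) P :=
  (integrable_const (1 : ℝ)).mono' (by fun_prop) (Eventually.of_forall fun y => by
    rw [Real.norm_eq_abs, abs_of_nonneg (by positivity)]
    exact min_le_left _ _)

lemma integrable_inner_apply_stdGaussian (A : E →L[ℝ] E) :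
    Integrable (fun ξ => ⟪ξ, A ξ⟫) (stdGaussian E) := by
  refine (integrable_norm_sq_stdGaussian.const_mul ‖A‖).mono' (by fun_prop)
    (Eventually.of_forall fun ξ => ?_)
  calc ‖⟪ξ, A ξ⟫‖ ≤ ‖ξ‖ * ‖A ξ‖ := norm_inner_le_norm _ _
    _ ≤ ‖ξ‖ * (‖A‖ * ‖ξ‖) := by gcongr; exact A.le_opNorm ξ
    _ = ‖A‖ * ‖ξ‖ ^ 2 := by ring

lemma tendsto_inv_mul_charFun_weighted (A : E →L[ℝ] E) (γ : E) {ν : Measure E} [SFinite ν]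
    (hν : Integrable (fun y => min 1 (‖y‖ ^ 2)) ν)
    (hre : ∀ ξ, 0 ≤ (levyExponent A γ ν ξ).re)
    {t : ℕ → ℝ} (ht : ∀ n, 0 < t n) (ht0 : Tendsto t atTop (𝓝 0))
    (P : ℕ → Measure E) [∀ n, IsProbabilityMeasure (P n)]
    (hP : ∀ n ξ, charFun (P n) ξ = Complex.exp (-(t n : ℂ) * levyExponent A γ ν ξ)) (η : E) :
    Tendsto (fun n => ((t n)⁻¹ : ℂ) * charFun (weighted (P n)) η) atTop
      (𝓝 ((∫ ξ, ⟪ξ, A ξ⟫ ∂(stdGaussian E) : ℝ) + charFun (weighted ν) η)) := by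
  obtain ⟨C, hC⟩ := exists_norm_levyExponent_le A γ hν
  have hlim : ((∫ ξ, ⟪ξ, A ξ⟫ ∂(stdGaussian E) : ℝ) : ℂ) + charFun (weighted ν) η =
      ∫ ξ, ((levyExponent A γ ν (η + ξ) + levyExponent A γ ν (η - ξ)) / 2 -
        levyExponent A γ ν η) ∂(stdGaussian E) := by
    simp_rw [levyExponent_second_difference A γ hν]
    have hi : Integrable (fun ξ => ∫ y, ((1 - Real.cos ⟪y, ξ⟫ : ℝ) : ℂ) *
        Complex.exp (⟪y, η⟫ * Complex.I) ∂ν) (stdGaussian E) :=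
      (integrable_prod_one_sub_cos_mul_exp hν η).integral_prod_left
    have hiA : Integrable (fun ξ => (⟪ξ, A ξ⟫ : ℂ)) (stdGaussian E) :=
      (integrable_inner_apply_stdGaussian A).ofReal
    rw [charFun_weighted hν, integral_add hiA hi,
      integral_complex_ofReal]
  rw [hlim]
  have hmul : ∀ n ξ, ((t n)⁻¹ : ℂ) *
      (charFun (P n) η - (charFun (P n) (η + ξ) + charFun (P n) (η - ξ)) / 2) =
      ((t n)⁻¹ : ℂ) * (charFun (P n) η - 1) - (((t n)⁻¹ : ℂ) * (charFun (P n) (η + ξ) - 1) +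
        ((t n)⁻¹ : ℂ) * (charFun (P n) (η - ξ) - 1)) / 2 := fun n ξ => by ring
  have hbound : ∀ n ξ, ‖((t n)⁻¹ : ℂ) * (charFun (P n) ξ - 1)‖ ≤ C * (1 + ‖ξ‖ ^ 2) := by
    intro n ξ
    rw [hP, neg_mul, norm_mul, norm_inv, Complex.norm_real, Real.norm_of_nonneg (ht n).le]
    have h := norm_exp_neg_sub_one_le (z := (t n : ℂ) * levyExponent A γ ν ξ) (by
      rw [Complex.re_ofReal_mul]; exact mul_nonneg (ht n).le (hre ξ))
    rw [norm_mul, Complex.norm_real, Real.norm_of_nonneg (ht n).le] at h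
    rw [inv_mul_le_iff₀ (ht n)]
    exact h.trans (mul_le_mul_of_nonneg_left (hC ξ) (ht n).le)
  have hform : ∀ n, ((t n)⁻¹ : ℂ) * charFun (weighted (P n)) η =
      ∫ ξ, (((t n)⁻¹ : ℂ) * (charFun (P n) η - 1) -
        (((t n)⁻¹ : ℂ) * (charFun (P n) (η + ξ) - 1) +
          ((t n)⁻¹ : ℂ) * (charFun (P n) (η - ξ) - 1)) / 2) ∂(stdGaussian E) := fun n => by
    rw [charFun_weighted (integrable_min_one_norm_sq_of_isFiniteMeasure (P n)),
      ← integral_const_mul]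
    simp_rw [integral_one_sub_cos_mul_exp, hmul]
  simp_rw [hform]
  refine tendsto_integral_of_dominated_convergence
    (fun ξ => C * (2 + 2 * ‖η‖ ^ 2) + C * ‖ξ‖ ^ 2) (fun n => ?_)
    ((integrable_const _).add (integrable_norm_sq_stdGaussian.const_mul C))
    (fun n => Eventually.of_forall fun ξ => ?_) (Eventually.of_forall fun ξ => ?_)
  · have := measurable_charFun (μ := P n)
    refine Measurable.aestronglyMeasurable ?_
    fun_prop
  · refine (norm_sub_le _ _).trans ?_
    rw [norm_div, Complex.norm_ofNat]
    have h1 := hbound n η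
    have h2 := norm_add_le (((t n)⁻¹ : ℂ) * (charFun (P n) (η + ξ) - 1))
      (((t n)⁻¹ : ℂ) * (charFun (P n) (η - ξ) - 1))
    have h3 := hbound n (η + ξ)
    have h4 := hbound n (η - ξ)
    have h5 : C * ‖η + ξ‖ ^ 2 + C * ‖η - ξ‖ ^ 2 = 2 * (C * ‖η‖ ^ 2 + C * ‖ξ‖ ^ 2) := by
      linear_combination C * parallelogram_law_with_norm ℝ η ξ
    linarith
  · have h := fun ζ => tendsto_inv_mul_exp_neg_mul_sub_one (levyExponent A γ ν ζ) ht ht0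
    simp_rw [hP]
    convert! (h η).sub (((h (η + ξ)).add (h (η - ξ))).div_const 2) using 2
    ring

lemma tendsto_inv_mul_integral_weighted (A : E →L[ℝ] E) (hA : ∀ x, 0 ≤ ⟪x, A x⟫) (γ : E)
    {ν : Measure E} [SFinite ν] (hν : Integrable (fun y => min 1 (‖y‖ ^ 2)) ν)
    (hre : ∀ ξ, 0 ≤ (levyExponent A γ ν ξ).re)
    {t : ℕ → ℝ} (ht : ∀ n, 0 < t n) (ht0 : Tendsto t atTop (𝓝 0))
    (P : ℕ → Measure E) [∀ n, IsProbabilityMeasure (P n)]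
    (hP : ∀ n ξ, charFun (P n) ξ = Complex.exp (-(t n : ℂ) * levyExponent A γ ν ξ))
    (f : BoundedContinuousFunction E ℝ) :
    Tendsto (fun n => (t n)⁻¹ * ∫ x, f x ∂(weighted (P n))) atTop
      (𝓝 ((∫ ξ, ⟪ξ, A ξ⟫ ∂(stdGaussian E)) * f 0 + ∫ x, f x ∂(weighted ν))) := by
  have hfin := fun n =>
    isFiniteMeasure_weighted (integrable_min_one_norm_sq_of_isFiniteMeasure (P n))
  have hfin₀ := isFiniteMeasure_weighted hν
  set c := ∫ ξ, ⟪ξ, A ξ⟫ ∂(stdGaussian E) with hc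
  have hc0 : 0 ≤ c := integral_nonneg hA
  have hexp : ∀ (μ : Measure E) [IsFiniteMeasure μ] (η : E),
      Integrable (fun x : E => Complex.exp (⟪x, η⟫ * Complex.I)) μ := fun μ _ η =>
    (integrable_const (1 : ℝ)).mono' (by fun_prop) (by simp [Complex.norm_exp_ofReal_mul_I])
  have hfinm : ∀ n, IsFiniteMeasure (ENNReal.ofReal (t n)⁻¹ • weighted (P n)) := fun n =>
    Measure.smul_finite _ ENNReal.ofReal_ne_top
  have hfinc : IsFiniteMeasure (ENNReal.ofReal c • Measure.dirac (0 : E)) :=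
    Measure.smul_finite _ ENNReal.ofReal_ne_top
  have h := tendsto_integral_of_tendsto_charFun
    (m := fun n => ENNReal.ofReal (t n)⁻¹ • weighted (P n))
    (m₀ := ENNReal.ofReal c • Measure.dirac 0 + weighted ν) (fun η => ?_) f
  · rw [integral_add_measure (f.integrable _) (f.integrable _), integral_smul_measure,
      integral_dirac, ENNReal.toReal_ofReal hc0, smul_eq_mul] at h
    simp_rw [integral_smul_measure, smul_eq_mul] at h
    simpa only [ENNReal.toReal_ofReal (inv_nonneg.2 (ht _).le)] using h
  · have h := tendsto_inv_mul_charFun_weighted A γ hν hre ht ht0 P hP η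
    rw [charFun_apply (μ := _ + _), integral_add_measure (hexp _ _) (hexp _ _),
      integral_smul_measure, integral_dirac, ENNReal.toReal_ofReal hc0]
    simp_rw [charFun_apply (μ := _ • _), integral_smul_measure,
      ENNReal.toReal_ofReal (inv_nonneg.2 (ht _).le)]
    simpa [charFun_apply, ← hc] using h

/-- The small-time limit `t⁻¹ ∫ g dp_t → ∫ g dν` for bounded continuous `g` vanishing near `0`. -/
lemma tendsto_inv_mul_integral_of_vanishing (A : E →L[ℝ] E) (hA : ∀ x, 0 ≤ ⟪x, A x⟫) (γ : E)
    {ν : Measure E} [SFinite ν] (hν : Integrable (fun y => min 1 (‖y‖ ^ 2)) ν)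
    (hre : ∀ ξ, 0 ≤ (levyExponent A γ ν ξ).re)
    {t : ℕ → ℝ} (ht : ∀ n, 0 < t n) (ht0 : Tendsto t atTop (𝓝 0))
    (P : ℕ → Measure E) [∀ n, IsProbabilityMeasure (P n)]
    (hP : ∀ n ξ, charFun (P n) ξ = Complex.exp (-(t n : ℂ) * levyExponent A γ ν ξ))
    {g : E → ℝ} (hg : Continuous g) {B : ℝ} (hB : ∀ x, |g x| ≤ B) {D : ℝ} (hD : 0 < D)
    (hgD : ∀ x, ‖x‖ < D → g x = 0) :
    Tendsto (fun n => (t n)⁻¹ * ∫ x, g x ∂(P n)) atTop (𝓝 (∫ x, g x ∂ν)) := by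
  set δ := 1 - Real.exp (-D ^ 2 / 2) with hδ
  have hδ0 : 0 < δ := by
    rw [hδ, sub_pos, Real.exp_lt_one_iff]
    have := pow_pos hD 2
    linarith
  have hmax : ∀ x : E, δ ≤ max (gaussWeight x) δ := fun x => le_max_right _ _
  have hmax0 : ∀ x : E, max (gaussWeight x) δ ≠ 0 := fun x => (hδ0.trans_le (hmax x)).ne'
  let f : BoundedContinuousFunction E ℝ := BoundedContinuousFunction.ofNormedAddCommGroup
    (fun x => g x / max (gaussWeight x) δ)
    (hg.div (continuous_gaussWeight.max continuous_const) hmax0) (B / δ) (fun x => by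
      rw [norm_div, Real.norm_eq_abs, Real.norm_of_nonneg (hδ0.le.trans (hmax x))]
      exact div_le_div₀ ((abs_nonneg _).trans (hB x)) (hB x) hδ0 (hmax x))
  have hf : ∀ x, gaussWeight x • f x = g x := by
    intro x
    change gaussWeight x * (g x / max (gaussWeight x) δ) = g x
    rcases lt_or_ge ‖x‖ D with hx | hx
    · simp [hgD x hx]
    · have hle : δ ≤ gaussWeight x := by
        rw [hδ, gaussWeight]
        gcongr
      rw [max_eq_left hle, mul_div_cancel₀ _ (hδ0.trans_le hle).ne']
  have hf0 : f 0 = 0 := by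
    change g 0 / _ = 0
    rw [hgD 0 (by simpa using hD), zero_div]
  simpa only [integral_weighted, hf, hf0, mul_zero, zero_add] using
    tendsto_inv_mul_integral_weighted A hA γ hν hre ht ht0 P hP f

open scoped symmDiff in
/-- The volume of `Ω ∩ (Ω₀ + x)` depends continuously on `x`. -/
lemma continuous_volume_inter_translate {Ω Ω₀ : Set E} (hΩ₀ : MeasurableSet Ω₀)
    (hΩfin : volume Ω < ⊤) (hΩ₀fin : volume Ω₀ < ⊤) :
    Continuous fun x => volume.real (Ω ∩ {y | y - x ∈ Ω₀}) := by
  rw [continuous_iff_continuousAt]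
  intro x₀
  let F : C(E × E, E) := ⟨fun z => z.2 - z.1, by fun_prop⟩
  have hmp : ∀ x, MeasurePreserving (F.curry x) volume volume := fun x =>
    measurePreserving_sub_right volume x
  have hlim := tendsto_measure_symmDiff_preimage_nhds_zero (μ := (volume : Measure E))
    (F.curry.continuous.tendsto x₀) (Eventually.of_forall hmp) (hmp x₀) hΩ₀.nullMeasurableSet
    hΩ₀fin.ne
  have hpre : ∀ x, F.curry x ⁻¹' Ω₀ = {y | y - x ∈ Ω₀} := fun x => rfl
  simp only [hpre] at hlim
  have hvol : ∀ x, volume {y | y - x ∈ Ω₀} ≠ ⊤ := fun x => by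
    rw [← hpre, (hmp x).measure_preimage hΩ₀.nullMeasurableSet]
    exact hΩ₀fin.ne
  have hfin : ∀ x x', volume (({y | y - x ∈ Ω₀}) ∆ {y | y - x' ∈ Ω₀}) ≠ ⊤ := fun x x' =>
    ((measure_mono Set.symmDiff_subset_union).trans_lt
      (measure_union_lt_top (hvol x).lt_top (hvol x').lt_top)).ne
  have hle : ∀ x x', volume.real (Ω ∩ {y | y - x ∈ Ω₀}) ≤
      volume.real (Ω ∩ {y | y - x' ∈ Ω₀}) +
        volume.real (({y | y - x ∈ Ω₀}) ∆ {y | y - x' ∈ Ω₀}) := by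
    intro x x'
    refine (measureReal_mono (fun y hy => ?_) ?_).trans (measureReal_union_le _ _)
    · by_cases h : y - x' ∈ Ω₀
      · exact Or.inl ⟨hy.1, h⟩
      · exact Or.inr (Or.inl ⟨hy.2, h⟩)
    · exact (measure_union_lt_top ((measure_mono Set.inter_subset_left).trans_lt hΩfin)
        (hfin x x').lt_top).ne
  have hreal := (ENNReal.tendsto_toReal ENNReal.zero_ne_top).comp hlim
  rw [ENNReal.toReal_zero] at hreal
  refine tendsto_iff_dist_tendsto_zero.2 (squeeze_zero (fun _ => dist_nonneg) (fun x => ?_) hreal)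
  rw [Real.dist_eq, abs_le]
  have h1 := hle x x₀
  have h2 := hle x₀ x
  rw [symmDiff_comm] at h2
  change -(volume.real _) ≤ _ ∧ _ ≤ volume.real _
  constructor <;> linarith

lemma measure_setOf_le_norm_lt_top {ν : Measure E}
    (hν : Integrable (fun y => min 1 (‖y‖ ^ 2)) ν) {D : ℝ} (hD : 0 < D) :
    ν {w | D ≤ ‖w‖} < ⊤ := by
  refine (measure_mono fun w hw => ?_).trans_lt
    (hν.measure_ge_lt_top (lt_min one_pos (pow_pos hD 2)))
  exact min_le_min_left _ (pow_le_pow_left₀ hD.le hw 2)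

lemma integral_volume_inter_translate_compl {ν : Measure E} [SFinite ν]
    (hν : Integrable (fun y => min 1 (‖y‖ ^ 2)) ν) {Ω Ω₀ : Set E} (hΩ : MeasurableSet Ω)
    (hΩ₀ : MeasurableSet Ω₀) (hΩfin : volume Ω < ⊤) {D : ℝ} (hD : 0 < D)
    (hdist : ∀ a ∈ Ω, ∀ b ∈ Ω₀ᶜ, D ≤ dist a b) :
    ∫ x, volume.real (Ω ∩ {y | y - x ∈ Ω₀ᶜ}) ∂ν =
      ∫ y in Ω, (ν {w | y - w ∈ Ω₀ᶜ}).toReal := by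
  set S : Set (E × E) := {z | z.2 ∈ Ω ∧ z.2 - z.1 ∈ Ω₀ᶜ} with hS
  have hSm : MeasurableSet S :=
    (measurable_snd hΩ).inter ((measurable_snd.sub measurable_fst) hΩ₀.compl)
  have hlt : ∀ x, volume (Ω ∩ {y | y - x ∈ Ω₀ᶜ}) < ⊤ := fun x =>
    (measure_mono Set.inter_subset_left).trans_lt hΩfin
  have hνlt : ∀ y ∈ Ω, ν {w | y - w ∈ Ω₀ᶜ} < ⊤ := fun y hy =>
    (measure_mono fun w hw => by simpa using hdist y hy (y - w) hw).trans_lt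
      (measure_setOf_le_norm_lt_top hν hD)
  have hm1 : Measurable fun x => volume (Ω ∩ {y | y - x ∈ Ω₀ᶜ}) :=
    measurable_measure_prodMk_left hSm
  have hm2 : Measurable fun y => ν ((fun x => (x, y)) ⁻¹' S) := measurable_measure_prodMk_right hSm
  have hind : ∀ y, ν ((fun x => (x, y)) ⁻¹' S) =
      Ω.indicator (fun y => ν {w | y - w ∈ Ω₀ᶜ}) y := by
    intro y
    by_cases hy : y ∈ Ω
    · rw [Set.indicator_of_mem hy]
      congr 1
      ext w
      simp [hS, hy]
    · rw [Set.indicator_of_notMem hy]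
      convert! measure_empty (μ := ν)
      ext w
      simp [hS, hy]
  have hm3 : AEMeasurable (fun y => ν {w | y - w ∈ Ω₀ᶜ}) (volume.restrict Ω) := by
    rw [← aemeasurable_indicator_iff hΩ]
    exact (funext hind ▸ hm2).aemeasurable
  simp only [measureReal_def]
  rw [integral_toReal hm1.aemeasurable (Eventually.of_forall hlt),
    integral_toReal hm3 ((ae_restrict_iff' hΩ).2 (Eventually.of_forall hνlt)),
    ← lintegral_indicator hΩ]
  simp only [← hind]
  rw [← Measure.prod_apply_symm (μ := ν) hSm, Measure.prod_apply hSm]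
  rfl

end LevyAux

/-- Example 2, Case 2: for a Lévy process with triplet (A, γ, ν) and open sets
Ω ⊂ Ω₀ of finite volume with dist(Ω, Ω₀^c) > 0, with r(x) = |Ω ∩ (Ω₀ + x)|
(so r(0) = |Ω|) one has
t⁻¹ (∫ r dp_t − r(0)) → −∫_Ω ν(y − Ω₀^c) dy as t → 0+. -/
theorem heat_content_nested_sets
    (d : ℕ) (hd : 1 ≤ d)
    -- generating triplet (A, γ, ν)
    (A : EuclideanSpace ℝ (Fin d) →L[ℝ] EuclideanSpace ℝ (Fin d))
    (hAsym : ∀ x y, ⟪A x, y⟫ = ⟪x, A y⟫) (hApos : ∀ x, 0 ≤ ⟪x, A x⟫)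
    (γ : EuclideanSpace ℝ (Fin d))
    (ν : Measure (EuclideanSpace ℝ (Fin d)))
    (hν0 : ν {0} = 0)
    (hνlevy : ∫⁻ y, ENNReal.ofReal (min 1 (‖y‖ ^ 2)) ∂ν < ⊤)
    -- the characteristic exponent
    (ψ : EuclideanSpace ℝ (Fin d) → ℂ)
    (hψ : ∀ ξ, ψ ξ = (⟪ξ, A ξ⟫ : ℂ) - Complex.I * (⟪ξ, γ⟫ : ℂ)
      - ∫ y, (Complex.exp (Complex.I * (⟪ξ, y⟫ : ℂ)) - 1
          - Complex.I * (if ‖y‖ ≤ 1 then (⟪ξ, y⟫ : ℂ) else 0)) ∂ν)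
    -- (p t) are the marginal laws of the process
    (p : ℝ → Measure (EuclideanSpace ℝ (Fin d)))
    (hp : ∀ t, 0 ≤ t → IsProbabilityMeasure (p t))
    (hchar : ∀ t, 0 ≤ t → ∀ ξ,
      ∫ x, Complex.exp (Complex.I * (⟪ξ, x⟫ : ℂ)) ∂(p t)
        = Complex.exp (-(t : ℂ) * ψ ξ))
    -- Ω ⊂ Ω₀ are open sets of finite volume with dist(Ω, Ω₀ᶜ) > 0
    (Ω Ω₀ : Set (EuclideanSpace ℝ (Fin d)))
    (hΩopen : IsOpen Ω) (hΩfin : volume Ω < ⊤)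
    (hΩ₀open : IsOpen Ω₀) (hΩ₀fin : volume Ω₀ < ⊤)
    (hsub : Ω ⊆ Ω₀)
    (D : ℝ) (hD : 0 < D)
    (hdist : ∀ a ∈ Ω, ∀ b ∈ Ω₀ᶜ, D ≤ dist a b)
    -- r(x) = |Ω ∩ (Ω₀ + x)|, so that r(0) = |Ω|
    (r : EuclideanSpace ℝ (Fin d) → ℝ)
    (hr : ∀ x, r x = (volume (Ω ∩ {y | y - x ∈ Ω₀})).toReal) :
    Tendsto (fun t : ℝ => t⁻¹ * ((∫ x, r x ∂(p t)) - r 0)) (𝓝[>] 0)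
      (𝓝 (-∫ y in Ω, (ν {w | y - w ∈ Ω₀ᶜ}).toReal)) := by
  have hν := integrable_min_one_norm_sq hνlevy
  have := sFinite_of_levy hν0 hνlevy
  have hψ' : ∀ ξ, ψ ξ = levyExponent A γ ν ξ := hψ
  have hchar' : ∀ t, 0 ≤ t → ∀ ξ,
      charFun (p t) ξ = Complex.exp (-(t : ℂ) * levyExponent A γ ν ξ) := by
    intro t ht ξ
    rw [← hψ', ← hchar t ht, charFun_apply]
    simp_rw [real_inner_comm, mul_comm Complex.I]
  have hre : ∀ ξ, 0 ≤ (levyExponent A γ ν ξ).re := by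
    intro ξ
    have := hp 1 zero_le_one
    have h := norm_charFun_le_one (μ := p 1) (t := ξ)
    rw [hchar' 1 zero_le_one, Complex.norm_exp, Real.exp_le_one_iff] at h
    simpa using h
  have hr' : r = fun x => volume.real (Ω ∩ {y | y - x ∈ Ω₀}) := funext hr
  have hcont : Continuous r := by
    rw [hr']
    exact continuous_volume_inter_translate hΩ₀open.measurableSet hΩfin hΩ₀fin
  have hr0 : r 0 = volume.real Ω := by
    simp only [hr', sub_zero, Set.ofPred_mem_eq]
    rw [Set.inter_eq_left.2 hsub]
  have hg : ∀ x, r 0 - r x = volume.real (Ω ∩ {y | y - x ∈ Ω₀ᶜ}) := by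
    intro x
    have hm : MeasurableSet {y | y - x ∈ Ω₀} := (measurable_id.sub_const x) hΩ₀open.measurableSet
    rw [hr0, hr', ← measureReal_inter_add_sdiff (s := Ω) hm hΩfin.ne, add_sub_cancel_left]
    rfl
  have hB : ∀ x, |r 0 - r x| ≤ volume.real Ω := by
    intro x
    rw [hg, abs_of_nonneg measureReal_nonneg]
    exact measureReal_mono Set.inter_subset_left hΩfin.ne
  have hgD : ∀ x, ‖x‖ < D → r 0 - r x = 0 := by
    intro x hx
    rw [hg]
    convert! measureReal_empty (μ := volume)
    ext y
    simp only [Set.mem_inter_iff, Set.mem_ofPred_eq, Set.mem_empty_iff_false, iff_false, not_and]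
    intro hy hy'
    have := hdist y hy _ hy'
    simp only [dist_self_sub_right] at this
    linarith
  have hlim : ∀ t : ℕ → ℝ, (∀ n, 0 < t n) → Tendsto t atTop (𝓝 0) →
      Tendsto (fun n => (t n)⁻¹ * ((∫ x, r x ∂(p (t n))) - r 0)) atTop
        (𝓝 (-∫ y in Ω, (ν {w | y - w ∈ Ω₀ᶜ}).toReal)) := by
    intro t ht ht0
    have hprob := fun n => hp (t n) (ht n).le
    have h := tendsto_inv_mul_integral_of_vanishing A hApos γ hν hre ht ht0 (fun n => p (t n))
      (fun n => hchar' _ (ht n).le) (g := fun x => r 0 - r x)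
      (continuous_const.sub hcont) hB hD hgD
    rw [← integral_volume_inter_translate_compl hν hΩopen.measurableSet hΩ₀open.measurableSet
      hΩfin hD hdist]
    simp_rw [← hg]
    refine h.neg.congr fun n => ?_
    have hi : Integrable r (p (t n)) := by
      refine (integrable_const (volume.real Ω)).mono' hcont.aestronglyMeasurable
        (Eventually.of_forall fun x => ?_)
      rw [hr', Real.norm_eq_abs, abs_of_nonneg measureReal_nonneg]
      exact measureReal_mono Set.inter_subset_left hΩfin.ne
    rw [integral_sub (integrable_const _) hi, integral_const, probReal_univ, one_smul]
    ring
  refine tendsto_of_seq_tendsto fun t ht => ?_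
  obtain ⟨ht0, htpos⟩ := tendsto_nhdsWithin_iff.1 ht
  obtain ⟨N, hN⟩ := eventually_atTop.1 htpos
  rw [← tendsto_add_atTop_iff_nat N]
  exact hlim (fun n => t (n + N)) (fun n => hN _ (Nat.le_add_left N n))
    ((tendsto_add_atTop_iff_nat N).2 ht0)
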